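/- Let {(𝔻, fₙ dz, gₙ)} be a sequence of Weierstrass m-triples on the unit disk 𝔻 such that gₙ converges locally uniformly on 𝔻 (with respect to the spherical distance) to a map g, and such that for every n: K_{ds²ₙ}(0) = −1/4 and −1 ≤ K_{ds²ₙ} ≤ 0 on 𝔻, where K_{ds²ₙ} is the Gaussian curvature of ds²ₙ = (1+|gₙ|²)^m |fₙ|² |dz|², and moreover dₙ(0) → ∞, where dₙ(0) is the geodesic distance from the origin to the boundary ∂𝔻 in the metric ds²ₙ. Then the limit g is nonconstant on 𝔻. -/

import Mathlib

open Filter Set MeasureTheory Topology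
open scoped ENNReal

noncomputable section

/-- Half of the chordal (spherical) distance on the Riemann sphere `OnePoint ℂ`. -/
def sphDist : OnePoint ℂ → OnePoint ℂ → ℝ
  | OnePoint.infty, OnePoint.infty => 0
  | OnePoint.infty, (w : ℂ) => 1 / Real.sqrt (1 + ‖w‖ ^ 2)
  | (z : ℂ), OnePoint.infty => 1 / Real.sqrt (1 + ‖z‖ ^ 2)
  | (z : ℂ), (w : ℂ) => ‖z - w‖ / (Real.sqrt (1 + ‖z‖ ^ 2) * Real.sqrt (1 + ‖w‖ ^ 2))

/-- A map `f : ℂ → Ĉ` is holomorphic on `U` if near each point of `U` it is, in the chart,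
either a coerced holomorphic function or the reciprocal of a holomorphic function. -/
def SphHolomorphicOn (f : ℂ → OnePoint ℂ) (U : Set ℂ) : Prop :=
  ∀ z ∈ U, ∃ V : Set ℂ, IsOpen V ∧ z ∈ V ∧ ∃ h : ℂ → ℂ, DifferentiableOn ℂ h V ∧
    ((∀ w ∈ V, f w = (h w : OnePoint ℂ)) ∨
     (∀ w ∈ V, f w = if h w = 0 then OnePoint.infty else (((h w)⁻¹ : ℂ) : OnePoint ℂ)))

/-- Locally uniform convergence on `U` with respect to the spherical distance. -/
def SphLocUnifOn (F : ℕ → ℂ → OnePoint ℂ) (f : ℂ → OnePoint ℂ) (U : Set ℂ) : Prop :=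
  ∀ K : Set ℂ, K ⊆ U → IsCompact K → ∀ ε > (0:ℝ),
    ∀ᶠ n in Filter.atTop, ∀ z ∈ K, sphDist (F n z) (f z) < ε

/-- Locally uniform convergence of real-valued functions on `U`. -/
def RealLocUnifOn (F : ℕ → ℂ → ℝ) (f : ℂ → ℝ) (U : Set ℂ) : Prop :=
  ∀ K : Set ℂ, K ⊆ U → IsCompact K → ∀ ε > (0:ℝ),
    ∀ᶠ n in Filter.atTop, ∀ z ∈ K, |F n z - f z| < ε

/-- A closed property for holomorphic maps into the Riemann sphere (on plane domains). -/
structure IsClosedProperty (P : Set ℂ → (ℂ → OnePoint ℂ) → Prop) : Prop where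
  mem_holo : ∀ (U : Set ℂ) (f : ℂ → OnePoint ℂ), IsOpen U → IsConnected U →
    P U f → SphHolomorphicOn f U
  /-- (P1): stability under precomposition with unramified holomorphic maps. -/
  comp : ∀ (U V : Set ℂ) (φ : ℂ → ℂ) (f : ℂ → OnePoint ℂ),
    IsOpen U → IsConnected U → IsOpen V → IsConnected V →
    DifferentiableOn ℂ φ U → Set.MapsTo φ U V → (∀ z ∈ U, deriv φ z ≠ 0) →
    P V f → P U (f ∘ φ)
  /-- (P2): if `f` has the property on every relatively compact subdomain, it has it globally. -/
  exhaust : ∀ (U : Set ℂ) (f : ℂ → OnePoint ℂ), IsOpen U → IsConnected U →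
    SphHolomorphicOn f U →
    (∀ Ω : Set ℂ, IsOpen Ω → IsConnected Ω → IsCompact (closure Ω) → closure Ω ⊆ U → P Ω f) →
    P U f
  /-- (P3): `𝒫(U)` is closed under locally uniform spherical convergence in `𝑀(U)`. -/
  closed : ∀ (U : Set ℂ) (f : ℂ → OnePoint ℂ) (F : ℕ → ℂ → OnePoint ℂ),
    IsOpen U → IsConnected U → (∀ n, P U (F n)) → SphLocUnifOn F f U →
    SphHolomorphicOn f U → P U f

/-- A compact property: a closed property all of whose families `𝒫(U)` are normal. -/
structure IsCompactProperty (P : Set ℂ → (ℂ → OnePoint ℂ) → Prop) extends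
    IsClosedProperty P : Prop where
  /-- (P4): normality of `𝒫(U)` for every domain `U`. -/
  normal : ∀ (U : Set ℂ), IsOpen U → IsConnected U →
    ∀ F : ℕ → ℂ → OnePoint ℂ, (∀ n, P U (F n)) →
      ∃ φ : ℕ → ℕ, StrictMono φ ∧ ∃ g : ℂ → OnePoint ℂ, SphLocUnifOn (F ∘ φ) g U

/-- The spherical derivative of a map into the Riemann sphere (limit of spherical
difference quotients). For `f` meromorphic near `z` this equals `|f'|/(1+|f|²)`. -/
def sphD (f : ℂ → OnePoint ℂ) (z : ℂ) : ℝ :=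
  limUnder (𝓝[≠] z) (fun w => sphDist (f w) (f z) / ‖w - z‖)

/-- A Weierstrass `m`-triple on a plane domain `U`: a holomorphic `1`-form `f dz`, a
meromorphic function `g`, and the (continuous positive) conformal density `lam` of the
metric `ds² = (1+|g|²)^m |f|² |dz|²`. -/
structure WeierstrassTriple (m : ℕ) (U : Set ℂ) where
  isOpen : IsOpen U
  isConnected : IsConnected U
  f : ℂ → ℂ
  g : ℂ → OnePoint ℂ
  f_holo : DifferentiableOn ℂ f U
  g_holo : SphHolomorphicOn g U
  g_mero : ∃ z ∈ U, g z ≠ OnePoint.infty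
  lam : ℂ → ℝ
  lam_cont : ContinuousOn lam U
  lam_pos : ∀ z ∈ U, 0 < lam z
  lam_eq : ∀ z ∈ U, ∀ w : ℂ, g z = (w : OnePoint ℂ) →
    lam z = (1 + ‖w‖ ^ 2) ^ ((m : ℝ) / 2) * ‖f z‖

/-- The Gaussian curvature `K = -2m |g'|²/((1+|g|²)^{m+2}|f|²)` of a Weierstrass
`m`-triple, written via the spherical derivative: `K = -2m (g^#)² / λ²`. -/
def WeierstrassTriple.curv {m : ℕ} {U : Set ℂ} (T : WeierstrassTriple m U) (z : ℂ) : ℝ :=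
  -(2 * m) * (sphD T.g z) ^ 2 / (T.lam z) ^ 2

/-- A divergent `C¹` path in `U` starting at `p`, parametrized by `[0,1)`. -/
structure DivergentPath (U : Set ℂ) (p : ℂ) where
  toFun : ℝ → ℂ
  start : toFun 0 = p
  mem : ∀ t ∈ Set.Ico (0:ℝ) 1, toFun t ∈ U
  cont : ContinuousOn toFun (Set.Ico (0:ℝ) 1)
  diff : ∀ t ∈ Set.Ioo (0:ℝ) 1, DifferentiableAt ℝ toFun t
  divergent : ∀ K : Set ℂ, IsCompact K → K ⊆ U →
    ∃ t₀ ∈ Set.Ico (0:ℝ) 1, ∀ t, t₀ ≤ t → t < 1 → toFun t ∉ K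

/-- The length of a path with respect to the conformal metric with density `lam`. -/
def pathLen (lam : ℂ → ℝ) (γ : ℝ → ℂ) : ℝ≥0∞ :=
  ∫⁻ t in Set.Ioo (0:ℝ) 1, ENNReal.ofReal (lam (γ t) * ‖deriv γ t‖)

/-- The geodesic distance from `p` to the boundary of `U`: the infimum of lengths of
divergent paths starting at `p`. -/
def distToBdry (lam : ℂ → ℝ) (U : Set ℂ) (p : ℂ) : ℝ≥0∞ :=
  ⨅ γ : DivergentPath U p, pathLen lam γ.toFun

/-- Completeness of the conformal metric with density `lam` on `U`: every divergent path
has infinite length. -/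
def IsCompleteMetric (lam : ℂ → ℝ) (U : Set ℂ) : Prop :=
  ∀ p ∈ U, ∀ γ : DivergentPath U p, pathLen lam γ.toFun = ⊤

/-- The property `P_L`: `|f| < L` on `U`, or `f` is constant on `U`. -/
def PL (L : ℝ) (U : Set ℂ) (f : ℂ → OnePoint ℂ) : Prop :=
  SphHolomorphicOn f U ∧
    ((∀ z ∈ U, ∃ w : ℂ, f z = (w : OnePoint ℂ) ∧ ‖w‖ < L) ∨
      (∀ z ∈ U, ∀ w ∈ U, f z = f w))

/-- The property `P_X`: `f` omits every value of `X`, or `f` is constant on `U`. -/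
def PX (X : Set (OnePoint ℂ)) (U : Set ℂ) (f : ℂ → OnePoint ℂ) : Prop :=
  SphHolomorphicOn f U ∧ ((∀ z ∈ U, f z ∉ X) ∨ (∀ z ∈ U, ∀ w ∈ U, f z = f w))

/-- Second directional derivative of `u : ℂ → ℝ` at `z` in direction `v`. -/
def dirDeriv2 (u : ℂ → ℝ) (z v : ℂ) : ℝ :=
  deriv (deriv (fun t : ℝ => u (z + t • v))) 0

/-- The Euclidean Laplacian of `u : ℂ → ℝ`. -/
def laplacian (u : ℂ → ℝ) (z : ℂ) : ℝ :=
  dirDeriv2 u z 1 + dirDeriv2 u z Complex.I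


/-- A compact property `P` satisfies the `m`-curvature estimate if there is `C > 0` such
that `|K| d² ≤ C` for every Weierstrass `m`-triple whose meromorphic function satisfies `P`. -/
def SatisfiesCurvatureEstimate (P : Set ℂ → (ℂ → OnePoint ℂ) → Prop) (m : ℕ) : Prop :=
  ∃ C : ℝ, 0 < C ∧ ∀ (U : Set ℂ) (T : WeierstrassTriple m U), P U T.g →
    ∀ p ∈ U, ENNReal.ofReal |T.curv p| * (distToBdry T.lam U p) ^ 2 ≤ ENNReal.ofReal C

section PathLifting

variable {E X : Type*} [TopologicalSpace E] {p : E → X}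

/-- `γ` is a continuous lift through `p` of the path `c` over the parameter set `s`, with initial
point `e₀`. -/
def IsLiftOn (p : E → X) (c : ℝ → X) (e₀ : E) (γ : ℝ → E) (s : Set ℝ) : Prop :=
  ContinuousOn γ s ∧ γ 0 = e₀ ∧ ∀ t ∈ s, p (γ t) = c t

lemma IsLiftOn.mono {c : ℝ → X} {e₀ : E} {γ : ℝ → E} {s t : Set ℝ} (h : IsLiftOn p c e₀ γ t)
    (hst : s ⊆ t) : IsLiftOn p c e₀ γ s :=
  ⟨h.1.mono hst, h.2.1, fun u hu => h.2.2 u (hst hu)⟩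

variable [TopologicalSpace X]

/-- A lift on `[0, t]` extends to `[0, s]` if the rest of the path stays in the target of a chart
around the end point. -/
lemma IsLiftOn.extend {c : ℝ → X} (hc : Continuous c) {e₀ : E} {γ : ℝ → E} {t s : ℝ}
    (ht : 0 ≤ t) (h : IsLiftOn p c e₀ γ (Icc 0 t)) (e : OpenPartialHomeomorph E X)
    (hpe : p = e) (hγ : γ t ∈ e.source) (hs : ∀ u ∈ Icc t s, c u ∈ e.target) :
    ∃ γ' : ℝ → E, IsLiftOn p c e₀ γ' (Icc 0 s) := by
  refine ⟨fun u => if u ≤ t then γ u else e.symm (c u), ?_, by simp [ht, h.2.1], ?_⟩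
  · have h1 : ContinuousOn (fun u => if u ≤ t then γ u else e.symm (c u)) (Icc 0 t) :=
      h.1.congr fun u hu => if_pos hu.2
    have h2 : ContinuousOn (fun u => if u ≤ t then γ u else e.symm (c u)) (Icc t s) := by
      refine (e.continuousOn_symm.comp hc.continuousOn hs).congr fun u hu => ?_
      by_cases hut : u ≤ t
      · obtain rfl : u = t := le_antisymm hut hu.1
        have := h.2.2 u ⟨ht, le_rfl⟩
        simp only [le_refl, if_true, Function.comp, ← this, hpe]
        exact (e.left_inv hγ).symm
      · simp [hut]
    refine (h1.union_of_isClosed h2 isClosed_Icc isClosed_Icc).mono fun u hu => ?_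
    rcases le_total u t with hut | hut
    · exact Or.inl ⟨hu.1, hut⟩
    · exact Or.inr ⟨hut, hu.2⟩
  · intro u hu
    by_cases hut : u ≤ t
    · simpa [hut] using h.2.2 u ⟨hu.1, hut⟩
    · simp only [hut, if_false, hpe]
      exact e.right_inv (hs u ⟨(not_le.1 hut).le, hu.2⟩)

/-- Lifts on all shorter closed intervals glue to a lift on `[0, s)`. -/
lemma exists_isLiftOn_Ico [T2Space E] (hp : IsLocalHomeomorph p) {c : ℝ → X} {e₀ : E} {s : ℝ}
    (h : ∀ t ∈ Ico 0 s, ∃ γ : ℝ → E, IsLiftOn p c e₀ γ (Icc 0 t)) (hs : 0 < s) :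
    ∃ γ : ℝ → E, IsLiftOn p c e₀ γ (Ico 0 s) := by
  have : Nonempty (ℝ → E) := ⟨fun _ => e₀⟩
  choose! Γ hΓ using h
  have key : ∀ t ∈ Ico 0 s, ∀ u ∈ Icc 0 t, Γ u u = Γ t u := by
    intro t ht u hu
    have hus : u ∈ Ico 0 s := ⟨hu.1, hu.2.trans_lt ht.2⟩
    have := (T2Space.isSeparatedMap p).eqOn_of_comp_eqOn hp.isLocallyInjective
      (s := Icc 0 u) (a := 0) isPreconnected_Icc (hΓ u hus).1
      ((hΓ t ht).1.mono (Icc_subset_Icc_right hu.2))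
      (fun v hv => ((hΓ u hus).2.2 v hv).trans
        ((hΓ t ht).2.2 v (Icc_subset_Icc_right hu.2 hv)).symm)
      ⟨le_rfl, hu.1⟩ ((hΓ u hus).2.1.trans (hΓ t ht).2.1.symm)
    exact this ⟨hu.1, le_rfl⟩
  refine ⟨fun t => Γ t t, ?_, (hΓ 0 ⟨le_rfl, hs⟩).2.1,
    fun t ht => (hΓ t ht).2.2 t ⟨ht.1, le_rfl⟩⟩
  intro u hu
  obtain ⟨t, hut, hts⟩ := exists_between hu.2
  have ht : t ∈ Ico 0 s := ⟨hu.1.trans hut.le, hts⟩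
  have h1 : ContinuousWithinAt (fun t => Γ t t) (Icc 0 t) u :=
    ((hΓ t ht).1.congr (key t ht)) u ⟨hu.1, hut.le⟩
  refine h1.mono_of_mem_nhdsWithin ?_
  filter_upwards [self_mem_nhdsWithin, mem_nhdsWithin_of_mem_nhds (Iio_mem_nhds hut)] with v hv hv'
  exact ⟨hv.1, le_of_lt hv'⟩

/-- A path lifts through a local homeomorphism if partial lifts always have a cluster point at
the end of their interval of definition. -/
theorem exists_isLiftOn_Icc [T2Space E] [T2Space X] (hp : IsLocalHomeomorph p) {c : ℝ → X}
    (hc : Continuous c) {e₀ : E} (he₀ : p e₀ = c 0)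
    (hclu : ∀ s ∈ Ioc (0 : ℝ) 1, ∀ γ : ℝ → E, IsLiftOn p c e₀ γ (Ico 0 s) →
      ∃ q, MapClusterPt q (𝓝[<] s) γ) :
    ∃ γ : ℝ → E, IsLiftOn p c e₀ γ (Icc 0 1) := by
  have h0 : ∃ γ : ℝ → E, IsLiftOn p c e₀ γ (Icc 0 0) :=
    ⟨fun _ => e₀, continuousOn_const, rfl, fun t ht => by
      obtain rfl : t = 0 := by simpa using ht
      exact he₀⟩
  set S : Set ℝ := {s | s ∈ Icc (0 : ℝ) 1 ∧ ∃ γ : ℝ → E, IsLiftOn p c e₀ γ (Icc 0 s)} with hS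
  have h0S : (0 : ℝ) ∈ S := ⟨by simp, h0⟩
  have hbdd : BddAbove S := ⟨1, fun s hs => hs.1.2⟩
  have hs0 : 0 ≤ sSup S := le_csSup hbdd h0S
  have hs1 : sSup S ≤ 1 := csSup_le ⟨0, h0S⟩ fun s hs => hs.1.2
  have hstep : ∃ η > 0, ∃ γ : ℝ → E, IsLiftOn p c e₀ γ (Icc 0 (sSup S + η)) := by
    have hchart : ∀ q : E, p q = c (sSup S) → ∃ e : OpenPartialHomeomorph E X, q ∈ e.source ∧
        p = e ∧ ∃ η > 0, ∀ u ∈ Icc (sSup S - η) (sSup S + η), c u ∈ e.target := by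
      intro q hq
      obtain ⟨e, hqe, rfl⟩ := hp q
      have : c ⁻¹' e.target ∈ 𝓝 (sSup S) :=
        hc.continuousAt.preimage_mem_nhds (e.open_target.mem_nhds (hq ▸ e.map_source hqe))
      obtain ⟨η, hη, h⟩ := Metric.nhds_basis_closedBall.mem_iff.1 this
      exact ⟨e, hqe, rfl, η, hη, fun u hu => h (by rwa [Real.closedBall_eq_Icc])⟩
    rcases hs0.eq_or_lt with hs | hs
    · obtain ⟨e, hqe, hpe, η, hη, h⟩ := hchart e₀ (by rw [← hs, he₀])
      obtain ⟨γ, hγ⟩ := h0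
      refine ⟨η, hη, hγ.extend hc le_rfl e hpe (by rwa [hγ.2.1]) fun u hu => h u ⟨?_, hu.2⟩⟩
      linarith [hu.1]
    · obtain ⟨γ, hγ⟩ := exists_isLiftOn_Ico hp (c := c) (e₀ := e₀) (s := sSup S) (fun t ht => by
        obtain ⟨s, hsS, hts⟩ := exists_lt_of_lt_csSup ⟨0, h0S⟩ ht.2
        obtain ⟨γ, hγ⟩ := hsS.2
        exact ⟨γ, hγ.mono (Icc_subset_Icc_right hts.le)⟩) hs
      obtain ⟨q, hq⟩ := hclu _ ⟨hs, hs1⟩ γ hγ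
      have hIco : ∀ᶠ t in 𝓝[<] sSup S, t ∈ Ico 0 (sSup S) := Ico_mem_nhdsLT hs
      have hpq : p q = c (sSup S) := by
        have h1 : MapClusterPt (p q) (𝓝[<] sSup S) (p ∘ γ) :=
          hq.continuousAt_comp hp.continuous.continuousAt
        have h2 : Tendsto (p ∘ γ) (𝓝[<] sSup S) (𝓝 (c (sSup S))) :=
          (hc.continuousAt.tendsto.mono_left nhdsWithin_le_nhds).congr'
            (hIco.mono fun t ht => (hγ.2.2 t ht).symm)
        by_contra hne
        exact (disjoint_nhds_nhds.2 hne).le_bot.not_gt (bot_lt_iff_ne_bot.2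
          (NeBot.ne (h1.clusterPt.neBot.mono (inf_le_inf le_rfl h2))))
      obtain ⟨e, hqe, hpe, η, hη, h⟩ := hchart q hpq
      have hfr := (mapClusterPt_iff_frequently.1 hq) e.source (e.open_source.mem_nhds hqe)
      obtain ⟨t, hte, ht, htη⟩ := (hfr.and_eventually (hIco.and
        (Ioo_mem_nhdsLT (sub_lt_self (sSup S) hη)))).exists
      exact ⟨η, hη, (hγ.mono (Icc_subset_Ico_right ht.2)).extend hc ht.1 e hpe hte
        fun u hu => h u ⟨htη.1.le.trans hu.1, hu.2⟩⟩
  obtain ⟨η, hη, γ, hγ⟩ := hstep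
  rcases hs1.eq_or_lt with hs | hs
  · exact ⟨γ, hγ.mono (Icc_subset_Icc_right (by linarith))⟩
  · have : min (sSup S + η) 1 ∈ S :=
      ⟨⟨le_min (by linarith) zero_le_one, min_le_right _ _⟩, γ,
        hγ.mono (Icc_subset_Icc_right (min_le_left _ _))⟩
    have := le_csSup hbdd this
    rcases min_le_iff.1 this with h | h <;> linarith

end PathLifting

section InverseBranch

lemma isLocalHomeomorph_comp_subtypeVal {F : ℂ → ℂ} {Ω : Set ℂ} (hΩ : IsOpen Ω)
    (hF : ∀ z ∈ Ω, ∃ d : ℂ, d ≠ 0 ∧ HasStrictDerivAt F d z) :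
    IsLocalHomeomorph (fun z : Ω => F z) := by
  have h1 : IsLocalHomeomorphOn F Ω := by
    intro z hz
    obtain ⟨d, hd, h⟩ := hF z hz
    exact ⟨(h.hasStrictFDerivAt_equiv hd).toOpenPartialHomeomorph F,
      (h.hasStrictFDerivAt_equiv hd).mem_toOpenPartialHomeomorph_source, rfl⟩
  rw [isLocalHomeomorph_iff_isLocalHomeomorphOn_univ]
  exact h1.comp hΩ.isOpenEmbedding_subtypeVal.isLocalHomeomorph.isLocalHomeomorphOn
    fun z _ => z.2

/-- Derivative of a lift of the ray `t ↦ t w`. -/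
lemma hasDerivWithinAt_of_lift_ray {F : ℂ → ℂ} {γ : ℝ → ℂ} {s : Set ℝ} {t : ℝ} {d w : ℂ}
    (hd : d ≠ 0) (hF : HasStrictDerivAt F d (γ t)) (ht : t ∈ s) (hγ : ContinuousWithinAt γ s t)
    (hlift : ∀ u ∈ s, F (γ u) = (u : ℂ) * w) : HasDerivWithinAt γ (d⁻¹ * w) s t := by
  have h1 : ∀ᶠ u in 𝓝[s] t, γ u = hF.localInverse F d (γ t) hd ((u : ℂ) * w) := by
    filter_upwards [self_mem_nhdsWithin, hγ.eventually (hF.eventually_left_inverse hd)]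
      with u hu hu'
    rw [← hlift u hu, hu']
  have h2 : HasDerivAt (hF.localInverse F d (γ t) hd) d⁻¹ ((t : ℂ) * w) := by
    rw [← hlift t ht]
    exact (hF.to_localInverse hd).hasDerivAt
  have h3 : HasDerivAt (fun u : ℝ => (u : ℂ) * w) w t := by
    simpa using (Complex.ofRealCLM.hasDerivAt (x := t)).mul_const w
  exact (h2.comp t h3).hasDerivWithinAt.congr_of_eventuallyEq_of_mem h1 ht

/-- If all rays of length less than `δ` lift through a local primitive `F` of `f`, then Cauchy's
estimate for the resulting inverse branch bounds `f` from below at the base point. -/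
lemma norm_lower_of_ray_lifts {F f : ℂ → ℂ} {Ω : Set ℂ} (hΩ : IsOpen Ω)
    (hΩD : Ω ⊆ Metric.ball 0 1) (h0 : (0 : ℂ) ∈ Ω) (hF0 : F 0 = 0)
    (hf : ∀ z ∈ Ω, f z ≠ 0) (hF : ∀ z ∈ Ω, HasStrictDerivAt F (f z) z) {δ : ℝ} (hδ : 0 < δ)
    (hlift : ∀ w : ℂ, ‖w‖ < δ → ∃ γ : ℝ → Ω,
      IsLiftOn (fun z : Ω => F z) (fun t : ℝ => (t : ℂ) * w) ⟨0, h0⟩ γ (Icc 0 1)) :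
    δ / 2 ≤ ‖f 0‖ := by
  have hloc := isLocalHomeomorph_comp_subtypeVal (F := F) hΩ fun z hz => ⟨f z, hf z hz, hF z hz⟩
  choose Γ hΓ using fun w : Metric.ball (0 : ℂ) δ => hlift w (mem_ball_zero_iff.1 w.2)
  have hcont : Continuous fun a : unitInterval × Metric.ball (0 : ℂ) δ => Γ a.2 a.1 := by
    refine hloc.continuous_lift (T2Space.isSeparatedMap _)
      (⟨fun a => ((a.1 : ℝ) : ℂ) * a.2, by fun_prop⟩ :
        C(unitInterval × Metric.ball (0 : ℂ) δ, ℂ)) ?_ ?_ ?_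
    · ext a
      exact (hΓ a.2).2.2 a.1 a.1.2
    · have : (fun a => Γ a ((0 : unitInterval) : ℝ)) = fun _ => (⟨0, h0⟩ : Ω) := by
        ext a
        simp [(hΓ a).2.1]
      exact this ▸ continuous_const
    · intro a
      exact (hΓ a).1.comp_continuous continuous_subtype_val fun t => t.2
  have hzero : (Γ ⟨0, by simpa using hδ⟩ 1 : ℂ) = 0 := by
    have := (T2Space.isSeparatedMap fun z : Ω => F z).eqOn_of_comp_eqOn hloc.isLocallyInjective
      (s := Icc (0 : ℝ) 1) (a := 0) isPreconnected_Icc (hΓ ⟨0, by simpa using hδ⟩).1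
      (continuousOn_const (c := (⟨0, h0⟩ : Ω)))
      (fun v hv => by simpa [hF0] using (hΓ ⟨0, by simpa using hδ⟩).2.2 v hv)
      ⟨le_rfl, zero_le_one⟩ (hΓ _).2.1
    exact congrArg Subtype.val (this ⟨zero_le_one, le_rfl⟩)
  classical
  let Φ : ℂ → ℂ := fun w => if h : w ∈ Metric.ball (0 : ℂ) δ then Γ ⟨w, h⟩ 1 else 0
  have hΦeq : ∀ (w : ℂ) (hw : w ∈ Metric.ball (0 : ℂ) δ), Φ w = Γ ⟨w, hw⟩ 1 :=
    fun w hw => dif_pos hw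
  have hΦΩ : ∀ w ∈ Metric.ball (0 : ℂ) δ, Φ w ∈ Ω := fun w hw => hΦeq w hw ▸ (Γ ⟨w, hw⟩ 1).2
  have hΦF : ∀ w ∈ Metric.ball (0 : ℂ) δ, F (Φ w) = w := fun w hw => by
    simpa [hΦeq w hw] using (hΓ ⟨w, hw⟩).2.2 1 ⟨zero_le_one, le_rfl⟩
  have hΦcont : ContinuousOn Φ (Metric.ball 0 δ) := by
    rw [continuousOn_iff_continuous_domRestrict]
    have h1 : Continuous fun a : Metric.ball (0 : ℂ) δ => (Γ a ((1 : unitInterval) : ℝ) : ℂ) :=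
      continuous_subtype_val.comp (hcont.comp (Continuous.prodMk_right (1 : unitInterval)))
    convert h1 using 1
    ext a
    exact hΦeq a a.2
  have hΦd : ∀ w ∈ Metric.ball (0 : ℂ) δ, HasDerivAt Φ (f (Φ w))⁻¹ w := fun w hw =>
    (hF _ (hΦΩ w hw)).hasDerivAt.of_local_left_inverse
      (hΦcont.continuousAt (Metric.isOpen_ball.mem_nhds hw)) (hf _ (hΦΩ w hw))
      (Filter.eventually_of_mem (Metric.isOpen_ball.mem_nhds hw) hΦF)
  have hsub : Metric.closedBall (0 : ℂ) (δ / 2) ⊆ Metric.ball 0 δ :=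
    Metric.closedBall_subset_ball (by linarith)
  have hcauchy := Complex.norm_deriv_le_of_forall_mem_sphere_norm_le (f := Φ) (c := 0)
    (R := δ / 2) (C := 1) (by linarith)
    (DifferentiableOn.diffContOnCl (fun w hw => (hΦd w (hsub
      (Metric.closure_ball_subset_closedBall hw))).differentiableAt.differentiableWithinAt))
    (fun w hw => by
      have := hΩD (hΦΩ w (hsub (Metric.sphere_subset_closedBall hw)))
      exact (mem_ball_zero_iff.1 this).le)
  have h0δ : (0 : ℂ) ∈ Metric.ball (0 : ℂ) δ := by simpa using hδ
  have hΦ0 : Φ 0 = 0 := (hΦeq 0 h0δ).trans hzero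
  rw [(hΦd 0 h0δ).deriv, hΦ0, norm_inv, one_div] at hcauchy
  exact (inv_le_inv₀ (norm_pos_iff.2 (hf 0 h0)) (by linarith)).1 hcauchy

end InverseBranch

section Charts

/-- The finite value of a point of the Riemann sphere, with junk value `0` at infinity. -/
def finitePart (x : OnePoint ℂ) : ℂ := x.elim 0 id

@[simp] lemma finitePart_coe (w : ℂ) : finitePart (w : OnePoint ℂ) = w := rfl

variable {g : ℂ → OnePoint ℂ} {U : Set ℂ} {z : ℂ}

/-- Near a finite value, a spherically holomorphic map is an ordinary holomorphic function. -/
lemma SphHolomorphicOn.differentiableAt_finitePart (hg : SphHolomorphicOn g U) (hz : z ∈ U)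
    {w : ℂ} (hw : g z = w) :
    (∀ᶠ u in 𝓝 z, g u = (finitePart (g u) : OnePoint ℂ)) ∧
      DifferentiableAt ℂ (fun u => finitePart (g u)) z := by
  obtain ⟨V, hV, hzV, h, hd, hc | hc⟩ := hg z hz
  · have hev : ∀ᶠ u in 𝓝 z, g u = h u := Filter.eventually_of_mem (hV.mem_nhds hzV) hc
    refine ⟨hev.mono fun u hu => by rw [hu, finitePart_coe], ?_⟩
    exact (hd.differentiableAt (hV.mem_nhds hzV)).congr_of_eventuallyEq
      (hev.mono fun u hu => by simp only [hu, finitePart_coe])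
  · have hdz := hd.differentiableAt (hV.mem_nhds hzV)
    have hz0 : h z ≠ 0 := fun h0 => by
      rw [hc z hzV, if_pos h0] at hw
      exact OnePoint.infty_ne_coe w hw
    have hev : ∀ᶠ u in 𝓝 z, g u = ((h u)⁻¹ : ℂ) := by
      filter_upwards [hV.mem_nhds hzV, hdz.continuousAt.eventually_ne hz0] with u hu hu0
      rw [hc u hu, if_neg hu0]
    refine ⟨hev.mono fun u hu => by rw [hu, finitePart_coe], ?_⟩
    exact (hdz.inv hz0).congr_of_eventuallyEq (hev.mono fun u hu => by
      simp only [hu, finitePart_coe, Pi.inv_apply])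

/-- Bounded finite values persist at limit points of the domain. -/
lemma SphHolomorphicOn.exists_norm_le_of_mem_closure (hg : SphHolomorphicOn g U) (hz : z ∈ U)
    {M : ℝ} (hM : 0 < M) (hcl : z ∈ closure {u | ∃ w : ℂ, g u = w ∧ ‖w‖ ≤ M}) :
    ∃ w : ℂ, g z = w ∧ ‖w‖ ≤ M := by
  rw [mem_closure_iff_frequently] at hcl
  obtain ⟨V, hV, hzV, h, hd, hc | hc⟩ := hg z hz
  · refine ⟨h z, hc z hzV, ?_⟩
    by_contra! hlt
    have hcont := (hd.differentiableAt (hV.mem_nhds hzV)).continuousAt.norm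
    obtain ⟨u, ⟨w, hw, hwM⟩, huV, hu⟩ :=
      (hcl.and_eventually ((hV.eventually_mem hzV).and (hcont.eventually_const_lt hlt))).exists
    rw [hc u huV, OnePoint.coe_eq_coe] at hw
    exact absurd hwM (not_le.2 (hw ▸ hu))
  · have hle : M⁻¹ ≤ ‖h z‖ := by
      by_contra! hlt
      have hcont := (hd.differentiableAt (hV.mem_nhds hzV)).continuousAt.norm
      obtain ⟨u, ⟨w, hw, hwM⟩, huV, hu⟩ :=
        (hcl.and_eventually ((hV.eventually_mem hzV).and (hcont.eventually_lt_const hlt))).exists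
      rw [hc u huV] at hw
      split_ifs at hw with h0
      · exact OnePoint.infty_ne_coe w hw
      · rw [OnePoint.coe_eq_coe] at hw
        rw [← hw, norm_inv, inv_le_comm₀ (norm_pos_iff.2 h0) hM] at hwM
        exact absurd hwM (not_le.2 hu)
    have h0 : h z ≠ 0 := norm_pos_iff.1 ((inv_pos.2 hM).trans_le hle)
    refine ⟨(h z)⁻¹, by rw [hc z hzV, if_neg h0], ?_⟩
    rwa [norm_inv, inv_le_comm₀ (norm_pos_iff.2 h0) hM]

end Charts

section LowerBound

/-- A path whose closure in the disk is not compact cannot be short: the end of a curve of length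
less than the distance to the boundary accumulates inside the disk. -/
lemma exists_mapClusterPt_of_short {lam : ℂ → ℝ} {U : Set ℂ} {σ : ℝ → ℂ} {σ' : ℝ → ℂ} {s : ℝ}
    (hs : s ∈ Ioc (0 : ℝ) 1) (hσU : ∀ t ∈ Ico 0 s, σ t ∈ U) (hσc : ContinuousOn σ (Ico 0 s))
    (hσd : ∀ t ∈ Ioo 0 s, HasDerivAt σ (σ' t) t)
    (hlen : ∀ t ∈ Ioo 0 s, lam (σ t) * ‖σ' t‖ ≤ 1 / 2) (hlam : ∀ z ∈ U, 0 ≤ lam z)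
    (hd : 1 ≤ distToBdry lam U (σ 0)) :
    ∃ q ∈ U, MapClusterPt q (𝓝[<] s) σ := by
  have hmem : ∀ t ∈ Ico (0 : ℝ) 1, s * t ∈ Ico 0 s := fun t ht =>
    ⟨mul_nonneg hs.1.le ht.1, by nlinarith [hs.1, ht.2]⟩
  have hmem' : ∀ t ∈ Ioo (0 : ℝ) 1, s * t ∈ Ioo 0 s := fun t ht =>
    ⟨mul_pos hs.1 ht.1, by nlinarith [hs.1, ht.2]⟩
  have hder : ∀ t ∈ Ioo (0 : ℝ) 1, HasDerivAt (fun t => σ (s * t)) (s • σ' (s * t)) t :=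
    fun t ht => (hσd _ (hmem' t ht)).scomp t (by simpa using (hasDerivAt_id t).const_mul s)
  have hnd : ¬ ∀ K : Set ℂ, IsCompact K → K ⊆ U →
      ∃ t₀ ∈ Set.Ico (0:ℝ) 1, ∀ t, t₀ ≤ t → t < 1 → σ (s * t) ∉ K := by
    intro hdiv
    let γ : DivergentPath U (σ 0) :=
      { toFun := fun t => σ (s * t)
        start := by simp
        mem := fun t ht => hσU _ (hmem t ht)
        cont := hσc.comp (by fun_prop) hmem
        diff := fun t ht => (hder t ht).differentiableAt
        divergent := hdiv }
    have h1 : pathLen lam γ.toFun ≤ ENNReal.ofReal (1 / 2) := by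
      calc pathLen lam γ.toFun
          ≤ ∫⁻ _ in Set.Ioo (0:ℝ) 1, ENNReal.ofReal (1 / 2) := by
            refine setLIntegral_mono' measurableSet_Ioo fun t ht => ?_
            refine ENNReal.ofReal_le_ofReal ?_
            change lam (σ (s * t)) * ‖deriv (fun t => σ (s * t)) t‖ ≤ 1 / 2
            rw [(hder t ht).deriv, norm_smul, Real.norm_of_nonneg hs.1.le]
            have h2 := hlen _ (hmem' t ht)
            have h3 : 0 ≤ lam (σ (s * t)) * ‖σ' (s * t)‖ :=
              mul_nonneg (hlam _ (hσU _ (hmem t ⟨ht.1.le, ht.2⟩))) (norm_nonneg _)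
            nlinarith [hs.1, hs.2]
        _ = ENNReal.ofReal (1 / 2) := by simp
    have h2 : (1 : ℝ≥0∞) ≤ ENNReal.ofReal (1 / 2) := hd.trans ((iInf_le _ γ).trans h1)
    rw [ENNReal.one_le_ofReal] at h2
    norm_num at h2
  push Not at hnd
  obtain ⟨K, hK, hKU, hfr⟩ := hnd
  have hfr' : ∃ᶠ u in 𝓝[<] s, σ u ∈ K := by
    intro hev
    obtain ⟨l, hl, hsub⟩ := (mem_nhdsLT_iff_exists_Ioo_subset' hs.1).1 hev
    have hl' : l < s := hl
    have hmax : max l 0 < s := max_lt hl' hs.1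
    obtain ⟨t, ht, ht1, htK⟩ := hfr ((max l 0 + s) / 2 / s)
      ⟨div_nonneg (by linarith [le_max_right l 0, hs.1]) hs.1.le,
        (div_lt_one hs.1).2 (by linarith)⟩
    rw [div_le_iff₀ hs.1] at ht
    exact hsub ⟨by linarith [le_max_left l 0, mul_comm t s], by nlinarith [hs.1]⟩ htK
  obtain ⟨q, hq, hclu⟩ := hK.exists_mapClusterPt_of_frequently hfr'
  exact ⟨q, hKU hq, hclu⟩

/-- If the density of the metric and the derivative of `g` are controlled by `f` as long as
`|g| < 2`, if `|g 0| ≤ 1`, and the boundary is far away, then `f` is bounded below at the base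
point. -/
theorem norm_lower_of_distToBdry {f : ℂ → ℂ} {g : ℂ → OnePoint ℂ} {lam : ℂ → ℝ} {A : ℝ}
    (hA : 0 < A) (hf : DifferentiableOn ℂ f (Metric.ball 0 1))
    (hg : SphHolomorphicOn g (Metric.ball 0 1)) (hlam : ∀ z ∈ Metric.ball (0 : ℂ) 1, 0 < lam z)
    (hbound : ∀ z ∈ Metric.ball (0 : ℂ) 1, ∀ w : ℂ, g z = w → ‖w‖ < 2 →
      ‖deriv (fun u => finitePart (g u)) z‖ ≤ A * ‖f z‖ ∧ lam z ≤ A * ‖f z‖)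
    {w₀ : ℂ} (hg0 : g 0 = w₀) (hw₀ : ‖w₀‖ ≤ 1)
    (hd : 1 ≤ distToBdry lam (Metric.ball 0 1) 0) : (4 * A)⁻¹ ≤ ‖f 0‖ := by
  set D : Set ℂ := Metric.ball 0 1
  have hDo : IsOpen D := Metric.isOpen_ball
  set G : ℂ → ℂ := fun u => finitePart (g u) with hG
  set Ω : Set ℂ := {z | z ∈ D ∧ ∃ w : ℂ, g z = w ∧ ‖w‖ < 2} with hΩdef
  have hΩD : Ω ⊆ D := fun z hz => hz.1
  have hΩG : ∀ z ∈ Ω, DifferentiableAt ℂ G z := fun z hz => by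
    obtain ⟨w, hw, -⟩ := hz.2
    exact (hg.differentiableAt_finitePart hz.1 hw).2
  have hΩo : IsOpen Ω := by
    rw [isOpen_iff_mem_nhds]
    rintro z hz
    obtain ⟨w, hw, hw2⟩ := hz.2
    have hGz : ‖G z‖ < 2 := by simpa [hG, hw] using hw2
    filter_upwards [hDo.mem_nhds hz.1, (hg.differentiableAt_finitePart hz.1 hw).1,
      (hΩG z hz).continuousAt.norm.eventually_lt_const hGz] with u hu1 hu2 hu3
    exact ⟨hu1, G u, hu2, hu3⟩
  have hΩb : ∀ z ∈ Ω, ‖deriv G z‖ ≤ A * ‖f z‖ ∧ lam z ≤ A * ‖f z‖ := fun z hz => by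
    obtain ⟨w, hw, hw2⟩ := hz.2
    exact hbound z hz.1 w hw hw2
  have hΩf : ∀ z ∈ Ω, f z ≠ 0 := fun z hz h0 => by
    have := (hΩb z hz).2
    rw [h0, norm_zero, mul_zero] at this
    exact absurd (hlam z hz.1) (not_lt.2 this)
  have h0D : (0 : ℂ) ∈ D := by simp [D]
  have h0Ω : (0 : ℂ) ∈ Ω := ⟨h0D, w₀, hg0, by linarith⟩
  obtain ⟨F₀, hF₀⟩ := hf.isExactOn_ball
  set F : ℂ → ℂ := fun z => F₀ z - F₀ 0 with hFdef
  have hFd : ∀ z ∈ D, HasDerivAt F (f z) z := fun z hz => (hF₀ z hz).sub_const _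
  have hF : ∀ z ∈ Ω, HasStrictDerivAt F (f z) z := fun z hz => by
    have h1 : DifferentiableOn ℂ F D :=
      fun z hz => (hFd z hz).differentiableAt.differentiableWithinAt
    have h2 := (h1.analyticAt (hDo.mem_nhds hz.1)).hasStrictDerivAt
    rwa [(hFd z hz.1).deriv] at h2
  have hloc := isLocalHomeomorph_comp_subtypeVal hΩo fun z hz => ⟨f z, hΩf z hz, hF z hz⟩
  have hmain := norm_lower_of_ray_lifts (δ := (2 * A)⁻¹) hΩo hΩD h0Ω (by simp [hFdef]) hΩf hF
    (by positivity) fun w hw => ?_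
  · convert hmain using 1
    field_simp
    norm_num
  have hAw : A * ‖w‖ ≤ 1 / 2 := by
    have := mul_le_mul_of_nonneg_left hw.le hA.le
    calc A * ‖w‖ ≤ A * (2 * A)⁻¹ := this
      _ = 1 / 2 := by field_simp
  refine exists_isLiftOn_Icc hloc (by fun_prop) (by simp [hFdef]) fun s hs γ hγ => ?_
  set σ : ℝ → ℂ := fun t => γ t with hσ
  have hσΩ : ∀ t, σ t ∈ Ω := fun t => (γ t).2
  have hσ0 : σ 0 = 0 := congrArg Subtype.val hγ.2.1
  have hσc : ContinuousOn σ (Ico 0 s) := continuous_subtype_val.comp_continuousOn hγ.1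
  have hσd : ∀ t ∈ Ico 0 s, HasDerivWithinAt σ ((f (σ t))⁻¹ * w) (Ico 0 s) t := fun t ht =>
    hasDerivWithinAt_of_lift_ray (hΩf _ (hσΩ t)) (hF _ (hσΩ t)) ht (hσc t ht) hγ.2.2
  have hspeed : ∀ (t x : ℝ), x ≤ A * ‖f (σ t)‖ → x * ‖(f (σ t))⁻¹ * w‖ ≤ 1 / 2 := by
    intro t x hx
    have hpos : 0 < ‖f (σ t)‖ := norm_pos_iff.2 (hΩf _ (hσΩ t))
    calc x * ‖(f (σ t))⁻¹ * w‖ ≤ A * ‖f (σ t)‖ * ‖(f (σ t))⁻¹ * w‖ := by gcongr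
      _ = A * ‖w‖ := by rw [norm_mul, norm_inv]; field_simp
      _ ≤ 1 / 2 := hAw
  have hGb : ∀ t ∈ Ico 0 s, ∃ v : ℂ, g (σ t) = v ∧ ‖v‖ ≤ 3 / 2 := by
    intro t ht
    have hsub : Icc 0 t ⊆ Ico 0 s := Icc_subset_Ico_right ht.2
    have h1 := norm_image_sub_le_of_norm_deriv_right_le_segment (f := fun u => G (σ u))
      (f' := fun u => deriv G (σ u) * ((f (σ u))⁻¹ * w)) (a := 0) (b := t) (C := 1 / 2)
      (fun u hu => (hΩG _ (hσΩ u)).continuousAt.comp_continuousWithinAt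
        ((hσc u (hsub hu)).mono hsub))
      (fun u hu => by
        have hu' : u ∈ Ico 0 s := hsub ⟨hu.1, hu.2.le⟩
        have h2 : HasDerivWithinAt σ ((f (σ u))⁻¹ * w) (Ici u) u :=
          (hσd u hu').mono_of_mem_nhdsWithin (Filter.mem_of_superset (Ico_mem_nhdsGE hu'.2)
            (Ico_subset_Ico_left hu'.1))
        exact (hΩG _ (hσΩ u)).hasDerivAt.comp_hasDerivWithinAt u h2)
      (fun u hu => by
        rw [norm_mul]
        exact hspeed u _ (hΩb _ (hσΩ u)).1)
      t ⟨ht.1, le_rfl⟩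
    obtain ⟨v, hv, -⟩ := (hσΩ t).2
    have hGt : G (σ t) = v := by simp [hG, hv]
    have hG0 : G (σ 0) = w₀ := by simp [hG, hσ0, hg0]
    refine ⟨v, hv, ?_⟩
    rw [hGt, hG0] at h1
    have h3 : ‖v‖ ≤ ‖v - w₀‖ + ‖w₀‖ := by simpa using norm_add_le (v - w₀) w₀
    have h4 : t ≤ 1 := ht.2.le.trans hs.2
    linarith
  obtain ⟨q, hqD, hq⟩ := exists_mapClusterPt_of_short (lam := lam) (U := D) (σ := σ)
    (σ' := fun t => (f (σ t))⁻¹ * w) hs (fun t _ => (hσΩ t).1) hσc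
    (fun t ht => (hσd t ⟨ht.1.le, ht.2⟩).hasDerivAt (Ico_mem_nhds ht.1 ht.2))
    (fun t _ => hspeed t _ (hΩb _ (hσΩ t)).2) (fun z hz => (hlam z hz).le) (by rwa [hσ0])
  have hqcl : q ∈ closure {u | ∃ v : ℂ, g u = v ∧ ‖v‖ ≤ 3 / 2} := by
    rw [mem_closure_iff_nhds]
    intro N hN
    obtain ⟨t, htN, ht⟩ := ((mapClusterPt_iff_frequently.1 hq N hN).and_eventually
      (Ico_mem_nhdsLT hs.1)).exists
    exact ⟨σ t, htN, hGb t ht⟩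
  obtain ⟨v, hv, hv2⟩ := hg.exists_norm_le_of_mem_closure hqD (by norm_num) hqcl
  have hqΩ : q ∈ Ω := ⟨hqD, v, hv, by linarith⟩
  exact ⟨⟨q, hqΩ⟩, (Topology.IsInducing.subtypeVal.mapClusterPt_iff
    (l := Filter.map γ (𝓝[<] s))).1 hq⟩

end LowerBound

section SphericalDerivative

lemma sphDist_coe (z w : ℂ) : sphDist (z : OnePoint ℂ) (w : OnePoint ℂ) =
    ‖z - w‖ / (Real.sqrt (1 + ‖z‖ ^ 2) * Real.sqrt (1 + ‖w‖ ^ 2)) := rfl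

lemma sphDist_infty_coe (w : ℂ) :
    sphDist OnePoint.infty (w : OnePoint ℂ) = 1 / Real.sqrt (1 + ‖w‖ ^ 2) := rfl

lemma sphDist_coe_infty (z : ℂ) :
    sphDist (z : OnePoint ℂ) OnePoint.infty = 1 / Real.sqrt (1 + ‖z‖ ^ 2) := rfl

variable {g : ℂ → OnePoint ℂ} {U : Set ℂ} {z : ℂ}

lemma SphHolomorphicOn.sphD_eq (hg : SphHolomorphicOn g U) (hz : z ∈ U) {w : ℂ} (hw : g z = w) :
    sphD g z = ‖deriv (fun u => finitePart (g u)) z‖ / (1 + ‖w‖ ^ 2) := by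
  obtain ⟨hev, hdiff⟩ := hg.differentiableAt_finitePart hz hw
  set G : ℂ → ℂ := fun u => finitePart (g u) with hG
  have hGz : G z = w := by simp [hG, hw]
  refine Tendsto.limUnder_eq ?_
  have h1 : Tendsto (fun u => ‖slope G z u‖ /
      (Real.sqrt (1 + ‖G u‖ ^ 2) * Real.sqrt (1 + ‖G z‖ ^ 2))) (𝓝[≠] z)
      (𝓝 (‖deriv G z‖ / (Real.sqrt (1 + ‖G z‖ ^ 2) * Real.sqrt (1 + ‖G z‖ ^ 2)))) := by
    refine (hasDerivAt_iff_tendsto_slope.1 hdiff.hasDerivAt).norm.div ?_ (by positivity)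
    have h2 : ContinuousAt
        (fun u => Real.sqrt (1 + ‖G u‖ ^ 2) * Real.sqrt (1 + ‖G z‖ ^ 2)) z :=
      ((continuousAt_const.add (hdiff.continuousAt.norm.pow 2)).sqrt).mul continuousAt_const
    exact h2.tendsto.mono_left nhdsWithin_le_nhds
  rw [Real.mul_self_sqrt (by positivity), hGz] at h1
  refine h1.congr' ?_
  filter_upwards [nhdsWithin_le_nhds hev] with u hu
  rw [hu, hw, sphDist_coe, slope_def_field, norm_div, hGz]
  exact div_right_comm _ _ _

/-- The inversion `x ↦ 1 / x` of the Riemann sphere. -/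
def sphInv (x : OnePoint ℂ) : OnePoint ℂ :=
  x.elim ((0 : ℂ) : OnePoint ℂ)
    fun w => if w = 0 then OnePoint.infty else ((w⁻¹ : ℂ) : OnePoint ℂ)

@[simp] lemma sphInv_infty : sphInv OnePoint.infty = ((0 : ℂ) : OnePoint ℂ) := rfl

lemma sphInv_coe (w : ℂ) :
    sphInv (w : OnePoint ℂ) = if w = 0 then OnePoint.infty else ((w⁻¹ : ℂ) : OnePoint ℂ) := rfl

lemma sqrt_one_add_norm_inv_sq {w : ℂ} (hw : w ≠ 0) :
    Real.sqrt (1 + ‖w⁻¹‖ ^ 2) = Real.sqrt (1 + ‖w‖ ^ 2) / ‖w‖ := by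
  have hpos : 0 < ‖w‖ := norm_pos_iff.2 hw
  rw [← Real.sqrt_sq hpos.le, ← Real.sqrt_div (by positivity), Real.sqrt_sq hpos.le, norm_inv]
  congr 1
  field_simp
  ring

lemma sphDist_sphInv (x y : OnePoint ℂ) : sphDist (sphInv x) (sphInv y) = sphDist x y := by
  induction x using OnePoint.rec with
  | infty =>
    induction y using OnePoint.rec with
    | infty => simp [sphDist_coe]; rfl
    | coe w =>
      by_cases hw : w = 0
      · simp [sphInv_coe, hw, sphDist_infty_coe, sphDist_coe_infty]
      · have hpos : 0 < ‖w‖ := norm_pos_iff.2 hw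
        simp only [sphInv_infty, sphInv_coe, hw, if_false, sphDist_coe, sphDist_infty_coe,
          sqrt_one_add_norm_inv_sq hw]
        simp
        field_simp
  | coe z =>
    induction y using OnePoint.rec with
    | infty =>
      by_cases hz : z = 0
      · simp [sphInv_coe, hz, sphDist_infty_coe, sphDist_coe_infty]
      · have hpos : 0 < ‖z‖ := norm_pos_iff.2 hz
        simp only [sphInv_infty, sphInv_coe, hz, if_false, sphDist_coe, sphDist_coe_infty,
          sqrt_one_add_norm_inv_sq hz]
        simp
        field_simp
    | coe w =>
      by_cases hz : z = 0 <;> by_cases hw : w = 0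
      · simp [sphInv_coe, hz, hw, sphDist_coe]; rfl
      · have hpos : 0 < ‖w‖ := norm_pos_iff.2 hw
        simp only [sphInv_coe, hz, hw, if_true, if_false, sphDist_coe, sphDist_infty_coe,
          sqrt_one_add_norm_inv_sq hw]
        simp
      · have hpos : 0 < ‖z‖ := norm_pos_iff.2 hz
        simp only [sphInv_coe, hz, hw, if_true, if_false, sphDist_coe, sphDist_coe_infty,
          sqrt_one_add_norm_inv_sq hz]
        simp
      · have hpz : 0 < ‖z‖ := norm_pos_iff.2 hz
        have hpw : 0 < ‖w‖ := norm_pos_iff.2 hw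
        simp only [sphInv_coe, hz, hw, if_false, sphDist_coe, sqrt_one_add_norm_inv_sq hz,
          sqrt_one_add_norm_inv_sq hw, inv_sub_inv hz hw, norm_div, norm_mul, norm_sub_rev w z]
        field_simp

lemma sphD_sphInv (g : ℂ → OnePoint ℂ) (z : ℂ) : sphD (fun u => sphInv (g u)) z = sphD g z := by
  simp only [sphD, sphDist_sphInv]

lemma SphHolomorphicOn.sphInv (hg : SphHolomorphicOn g U) :
    SphHolomorphicOn (fun u => sphInv (g u)) U := by
  intro z hz
  obtain ⟨V, hV, hzV, h, hd, hc | hc⟩ := hg z hz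
  · exact ⟨V, hV, hzV, h, hd, Or.inr fun w hw => by simp only [hc w hw, sphInv_coe]⟩
  · refine ⟨V, hV, hzV, h, hd, Or.inl fun w hw => ?_⟩
    beta_reduce
    rw [hc w hw]
    split_ifs with h0
    · rw [sphInv_infty, h0]
    · rw [sphInv_coe, if_neg (inv_ne_zero h0), inv_inv]

lemma norm_sub_le_of_sphDist_lt {c : ℂ} {η : ℝ} (hη : 0 < η) :
    ∃ ε > 0, ∀ x : OnePoint ℂ, sphDist x c < ε → ∃ w : ℂ, x = w ∧ ‖w - c‖ ≤ η := by
  set q := Real.sqrt (1 + ‖c‖ ^ 2) with hq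
  have hq0 : 0 < q := by positivity
  have hden : 0 < 1 + ‖c‖ + η := by positivity
  set ε := min (1 / q) (η / (q * (1 + ‖c‖ + η))) with hε
  refine ⟨ε, by positivity, fun x hx => ?_⟩
  induction x using OnePoint.rec with
  | infty =>
    rw [sphDist_infty_coe] at hx
    exact absurd (hx.trans_le (min_le_left _ _)) (lt_irrefl _)
  | coe w =>
    refine ⟨w, rfl, ?_⟩
    have h1 : ‖w - c‖ / (Real.sqrt (1 + ‖w‖ ^ 2) * q) < η / (q * (1 + ‖c‖ + η)) :=
      hx.trans_le (min_le_right _ _)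
    have h2 : Real.sqrt (1 + ‖w‖ ^ 2) ≤ 1 + ‖w‖ :=
      Real.sqrt_le_iff.2 ⟨by positivity, by nlinarith [norm_nonneg w]⟩
    have h3 : ‖w‖ ≤ ‖w - c‖ + ‖c‖ := by simpa using norm_add_le (w - c) c
    rw [div_lt_div_iff₀ (by positivity) (by positivity)] at h1
    have h4 : ‖w - c‖ * (1 + ‖c‖ + η) < η * Real.sqrt (1 + ‖w‖ ^ 2) := by
      refine lt_of_mul_lt_mul_left ?_ hq0.le
      linarith
    have h5 : ‖w - c‖ * (1 + ‖c‖ + η) < η * (1 + ‖w - c‖ + ‖c‖) :=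
      h4.trans_le (mul_le_mul_of_nonneg_left (by linarith) hη.le)
    by_contra! hlt
    nlinarith [norm_nonneg c]

/-- A spherically holomorphic map close to a constant has small spherical derivative. -/
lemma exists_abs_sphD_lt (c : OnePoint ℂ) {κ : ℝ} (hκ : 0 < κ) :
    ∃ ε > 0, ∀ g : ℂ → OnePoint ℂ, SphHolomorphicOn g (Metric.ball 0 1) →
      (∀ z ∈ Metric.closedBall (0 : ℂ) (1 / 2), sphDist (g z) c < ε) → |sphD g 0| < κ := by
  have hfin : ∀ c : ℂ, ∃ ε > 0, ∀ g : ℂ → OnePoint ℂ, SphHolomorphicOn g (Metric.ball 0 1) →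
      (∀ z ∈ Metric.closedBall (0 : ℂ) (1 / 2), sphDist (g z) c < ε) → |sphD g 0| < κ := by
    intro c
    obtain ⟨ε, hε, h⟩ := norm_sub_le_of_sphDist_lt (c := c) (η := κ / 4) (by linarith)
    refine ⟨ε, hε, fun g hg hclose => ?_⟩
    have hsub : Metric.closedBall (0 : ℂ) (1 / 2) ⊆ Metric.ball 0 1 :=
      Metric.closedBall_subset_ball (by norm_num)
    have hdiff : ∀ z ∈ Metric.closedBall (0 : ℂ) (1 / 2),
        DifferentiableAt ℂ (fun u => finitePart (g u)) z := fun z hz => by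
      obtain ⟨w, hw, -⟩ := h _ (hclose z hz)
      exact (hg.differentiableAt_finitePart (hsub hz) hw).2
    have h1 := Complex.norm_deriv_le_of_forall_mem_sphere_norm_le
      (f := fun u => finitePart (g u) - c) (c := 0) (R := 1 / 2) (C := κ / 4) (by norm_num)
      (DifferentiableOn.diffContOnCl fun z hz => ((hdiff z
        (Metric.closure_ball_subset_closedBall hz)).sub_const c).differentiableWithinAt)
      (fun z hz => by
        obtain ⟨w, hw, hwc⟩ := h _ (hclose z (Metric.sphere_subset_closedBall hz))
        simpa [hw] using hwc)
    rw [deriv_sub_const] at h1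
    have h0 : (0 : ℂ) ∈ Metric.closedBall (0 : ℂ) (1 / 2) := by simp
    obtain ⟨w, hw, -⟩ := h _ (hclose 0 h0)
    rw [hg.sphD_eq (hsub h0) hw, abs_of_nonneg (by positivity)]
    calc _ ≤ ‖deriv (fun u => finitePart (g u)) 0‖ :=
          div_le_self (norm_nonneg _) (by nlinarith [norm_nonneg w])
      _ ≤ κ / 4 / (1 / 2) := h1
      _ < κ := by linarith
  induction c using OnePoint.rec with
  | infty =>
    obtain ⟨ε, hε, h⟩ := hfin 0
    refine ⟨ε, hε, fun g hg hclose => ?_⟩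
    rw [← sphD_sphInv]
    refine h _ hg.sphInv fun z hz => ?_
    rw [← sphInv_infty, sphDist_sphInv]
    exact hclose z hz
  | coe c => exact hfin c

end SphericalDerivative

section Duality

lemma SphHolomorphicOn.eventually_eq_infty {g : ℂ → OnePoint ℂ} {U : Set ℂ} {z : ℂ}
    (hg : SphHolomorphicOn g U) (hz : z ∈ U)
    (hfr : ∃ᶠ u in 𝓝[≠] z, g u = OnePoint.infty) : ∀ᶠ u in 𝓝 z, g u = OnePoint.infty := by
  obtain ⟨V, hV, hzV, h, hd, hc | hc⟩ := hg z hz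
  · obtain ⟨u, hu, huV⟩ :=
      (hfr.and_eventually ((hV.eventually_mem hzV).filter_mono nhdsWithin_le_nhds)).exists
    rw [hc u huV] at hu
    exact absurd hu (OnePoint.coe_ne_infty _)
  · rcases (hd.analyticAt (hV.mem_nhds hzV)).eventually_eq_zero_or_eventually_ne_zero with h0 | h0
    · filter_upwards [h0, hV.eventually_mem hzV] with u hu huV
      rw [hc u huV, if_pos hu]
    · obtain ⟨u, hu, huV, hu0⟩ := (hfr.and_eventually
        (((hV.eventually_mem hzV).filter_mono nhdsWithin_le_nhds).and h0)).exists
      rw [hc u huV, if_neg hu0] at hu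
      exact absurd hu (OnePoint.coe_ne_infty _)

/-- The poles of a meromorphic function on a domain are isolated. -/
lemma SphHolomorphicOn.eventually_ne_infty {g : ℂ → OnePoint ℂ} {U : Set ℂ} {z : ℂ}
    (hg : SphHolomorphicOn g U) (hU : IsPreconnected U)
    (hne : ∃ z ∈ U, g z ≠ OnePoint.infty) (hz : z ∈ U) :
    ∀ᶠ u in 𝓝[≠] z, g u ≠ OnePoint.infty := by
  by_contra hfr
  set P : Set ℂ := {z | ∀ᶠ u in 𝓝 z, g u = OnePoint.infty} with hP
  have hPz : z ∈ P := hg.eventually_eq_infty hz fun h => hfr h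
  have hsub : U ⊆ P := by
    refine hU.subset_of_closure_inter_subset isOpen_setOfPred_eventually_nhds ⟨z, hz, hPz⟩ ?_
    rintro v ⟨hvc, hvU⟩
    by_contra hvP
    refine hvP (hg.eventually_eq_infty hvU (frequently_nhdsWithin_iff.2 ?_))
    refine (mem_closure_iff_frequently.1 hvc).mono fun u hu => ⟨hu.self_of_nhds, ?_⟩
    rintro rfl
    exact hvP hu
  obtain ⟨v, hv, hv0⟩ := hne
  exact hv0 (hsub hv).self_of_nhds

/-- The metric of a Weierstrass triple with Gauss map `g` is also given by the Gauss map `1 / g`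
and the holomorphic form `g ^ m f dz`. -/
lemma WeierstrassTriple.exists_dual {m : ℕ} {U : Set ℂ} (T : WeierstrassTriple m U) :
    ∃ F : ℂ → ℂ, DifferentiableOn ℂ F U ∧ ∀ z ∈ U, ∀ w : ℂ, sphInv (T.g z) = w →
      T.lam z = (1 + ‖w‖ ^ 2) ^ ((m : ℝ) / 2) * ‖F z‖ := by
  have hg := T.g_holo
  set f₀ : ℂ → ℂ := fun z => T.f z * finitePart (T.g z) ^ m with hf₀
  set F : ℂ → ℂ := fun z => limUnder (𝓝[≠] z) f₀ with hF
  have hlam : ∀ z ∈ U, ∀ w : ℂ, T.g z = w → T.lam z = Real.sqrt (1 + ‖w‖ ^ 2) ^ m * ‖T.f z‖ := by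
    intro z hz w hw
    rw [T.lam_eq z hz w hw, Real.rpow_div_two_eq_sqrt _ (by positivity), Real.rpow_natCast]
  have hdiff₀ : ∀ z ∈ U, T.g z ≠ OnePoint.infty → DifferentiableAt ℂ f₀ z := by
    intro z hz hz0
    obtain ⟨w, hw⟩ := OnePoint.ne_infty_iff_exists.1 hz0
    exact (T.f_holo.differentiableAt (T.isOpen.mem_nhds hz)).mul
      ((hg.differentiableAt_finitePart hz hw.symm).2.pow m)
  have hFeq : ∀ z ∈ U, T.g z ≠ OnePoint.infty → F z = f₀ z := fun z hz hz0 =>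
    ((hdiff₀ z hz hz0).continuousAt.tendsto.mono_left nhdsWithin_le_nhds).limUnder_eq
  have hle : ∀ z ∈ U, T.g z ≠ OnePoint.infty → ‖f₀ z‖ ≤ T.lam z := by
    intro z hz hz0
    obtain ⟨w, hw⟩ := OnePoint.ne_infty_iff_exists.1 hz0
    rw [hlam z hz w hw.symm, hf₀]
    simp only [← hw, finitePart_coe, norm_mul, norm_pow]
    rw [mul_comm]
    gcongr
    exact Real.le_sqrt_of_sq_le (by linarith)
  have hpunct : ∀ z ∈ U, ∀ᶠ u in 𝓝[≠] z, u ∈ U ∧ T.g u ≠ OnePoint.infty := fun z hz =>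
    ((T.isOpen.eventually_mem hz).filter_mono nhdsWithin_le_nhds).and
      (hg.eventually_ne_infty T.isConnected.isPreconnected T.g_mero hz)
  have hFd : ∀ z ∈ U, DifferentiableAt ℂ F z := by
    intro z hz
    have hlt : ∀ᶠ u in 𝓝 z, T.lam u < T.lam z + 1 :=
      (T.lam_cont.continuousAt (T.isOpen.mem_nhds hz)).eventually_lt_const (by linarith)
    obtain ⟨s, hs, hsub⟩ := mem_nhdsWithin_iff_exists_mem_nhds_inter.1
      ((hpunct z hz).and (nhdsWithin_le_nhds hlt))
    have hupd := Complex.differentiableOn_update_limUnder_of_bddAbove (f := f₀) hs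
      (fun u hu => (hdiff₀ u (hsub hu).1.1 (hsub hu).1.2).differentiableWithinAt)
      ⟨T.lam z + 1, by
        rintro _ ⟨u, hu, rfl⟩
        exact (hle u (hsub hu).1.1 (hsub hu).1.2).trans (hsub hu).2.le⟩
    refine (hupd.differentiableAt hs).congr_of_eventuallyEq ?_
    filter_upwards [hs] with u hu
    rcases eq_or_ne u z with rfl | hne
    · rw [Function.update_self]
    · rw [Function.update_of_ne hne]
      exact hFeq u (hsub ⟨hu, hne⟩).1.1 (hsub ⟨hu, hne⟩).1.2
  refine ⟨F, fun z hz => (hFd z hz).differentiableWithinAt, fun z hz w hw => ?_⟩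
  rw [Real.rpow_div_two_eq_sqrt _ (by positivity), Real.rpow_natCast]
  obtain ⟨hev, hdG⟩ := hg.sphInv.differentiableAt_finitePart hz hw
  set G : ℂ → ℂ := fun u => finitePart (sphInv (T.g u)) with hG
  have hGz : G z = w := by simp [hG, hw]
  have h1 : Tendsto T.lam (𝓝[≠] z) (𝓝 (T.lam z)) :=
    (T.lam_cont.continuousAt (T.isOpen.mem_nhds hz)).tendsto.mono_left nhdsWithin_le_nhds
  have h2 : Tendsto (fun u => Real.sqrt (1 + ‖G u‖ ^ 2) ^ m * ‖F u‖) (𝓝[≠] z)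
      (𝓝 (Real.sqrt (1 + ‖w‖ ^ 2) ^ m * ‖F z‖)) := by
    have hc : ContinuousAt (fun u => Real.sqrt (1 + ‖G u‖ ^ 2) ^ m * ‖F u‖) z :=
      ((continuousAt_const.add (hdG.continuousAt.norm.pow 2)).sqrt.pow m).mul
        (hFd z hz).continuousAt.norm
    rw [← hGz]
    exact hc.tendsto.mono_left nhdsWithin_le_nhds
  refine tendsto_nhds_unique h1 (h2.congr' ?_)
  filter_upwards [hpunct z hz, nhdsWithin_le_nhds hev] with u ⟨huU, hu0⟩ huG
  obtain ⟨v, hv⟩ := OnePoint.ne_infty_iff_exists.1 hu0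
  have hv0 : v ≠ 0 := by
    rintro rfl
    rw [← hv, sphInv_coe, if_pos rfl] at huG
    exact OnePoint.infty_ne_coe _ huG
  have hGu : G u = v⁻¹ := by simp [hG, ← hv, sphInv_coe, hv0]
  have hpos : 0 < ‖v‖ := norm_pos_iff.2 hv0
  rw [hlam u huU v hv.symm, hFeq u huU hu0, hf₀, hGu, sqrt_one_add_norm_inv_sq hv0]
  simp only [← hv, finitePart_coe, norm_mul, norm_pow, div_pow]
  field_simp

end Duality

section DensityBound

/-- If the boundary is far away and the spherical derivative of the Gauss map is bounded by the
density, then the density is bounded below at the base point. -/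
lemma density_lower_of_norm_le_one {m : ℕ} {f : ℂ → ℂ} {g : ℂ → OnePoint ℂ} {lam : ℂ → ℝ}
    (hf : DifferentiableOn ℂ f (Metric.ball 0 1)) (hg : SphHolomorphicOn g (Metric.ball 0 1))
    (hlam : ∀ z ∈ Metric.ball (0 : ℂ) 1, 0 < lam z)
    (hlam_eq : ∀ z ∈ Metric.ball (0 : ℂ) 1, ∀ w : ℂ, g z = w →
      lam z = (1 + ‖w‖ ^ 2) ^ ((m : ℝ) / 2) * ‖f z‖)
    (hD : ∀ z ∈ Metric.ball (0 : ℂ) 1, sphD g z ≤ lam z)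
    {w₀ : ℂ} (hg0 : g 0 = w₀) (hw₀ : ‖w₀‖ ≤ 1)
    (hd : 1 ≤ distToBdry lam (Metric.ball 0 1) 0) :
    (4 * (5 * (5 : ℝ) ^ ((m : ℝ) / 2)))⁻¹ ≤ lam 0 := by
  have hone : ∀ w : ℂ, 1 ≤ 1 + ‖w‖ ^ 2 := fun w => le_add_of_nonneg_right (by positivity)
  have h0 : (0 : ℂ) ∈ Metric.ball (0 : ℂ) 1 := by simp
  have hf0 : ‖f 0‖ ≤ lam 0 := by
    rw [hlam_eq 0 h0 w₀ hg0]
    exact le_mul_of_one_le_left (norm_nonneg _) (Real.one_le_rpow (hone w₀) (by positivity))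
  refine (norm_lower_of_distToBdry (by positivity) hf hg hlam ?_ hg0 hw₀ hd).trans hf0
  intro z hz w hw hw2
  have h5 : 1 + ‖w‖ ^ 2 ≤ 5 := by nlinarith [norm_nonneg w]
  have h1 : lam z ≤ (5 : ℝ) ^ ((m : ℝ) / 2) * ‖f z‖ := by
    rw [hlam_eq z hz w hw]
    gcongr
  have h2 := hD z hz
  rw [hg.sphD_eq hz hw, div_le_iff₀ (by positivity)] at h2
  have h3 := hlam z hz
  constructor
  · calc _ ≤ lam z * (1 + ‖w‖ ^ 2) := h2
      _ ≤ (5 : ℝ) ^ ((m : ℝ) / 2) * ‖f z‖ * 5 := by gcongr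
      _ = _ := by ring
  · linarith

/-- A Weierstrass triple with curvature at least `-1` and the boundary at distance at least `1`
has density bounded below at the base point. -/
theorem WeierstrassTriple.density_lower {m : ℕ} (hm : 0 < m)
    (T : WeierstrassTriple m (Metric.ball (0 : ℂ) 1))
    (hK : ∀ z ∈ Metric.ball (0 : ℂ) 1, -1 ≤ T.curv z)
    (hd : 1 ≤ distToBdry T.lam (Metric.ball 0 1) 0) :
    (4 * (5 * (5 : ℝ) ^ ((m : ℝ) / 2)))⁻¹ ≤ T.lam 0 := by
  have hD : ∀ z ∈ Metric.ball (0 : ℂ) 1, sphD T.g z ≤ T.lam z := by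
    intro z hz
    have hpos := T.lam_pos z hz
    have h1 := hK z hz
    rw [WeierstrassTriple.curv, le_div_iff₀ (by positivity)] at h1
    have hm1 : (1 : ℝ) ≤ m := by exact_mod_cast hm
    refine le_of_sq_le_sq ?_ hpos.le
    nlinarith [sq_nonneg (sphD T.g z)]
  have hdual : ∀ w : ℂ, sphInv (T.g 0) = w → ‖w‖ ≤ 1 →
      (4 * (5 * (5 : ℝ) ^ ((m : ℝ) / 2)))⁻¹ ≤ T.lam 0 := by
    intro w hw hw1
    obtain ⟨F, hF, hFlam⟩ := T.exists_dual
    exact density_lower_of_norm_le_one hF T.g_holo.sphInv T.lam_pos hFlam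
      (fun z hz => (sphD_sphInv T.g z).trans_le (hD z hz)) hw hw1 hd
  rcases h0 : T.g 0 with _ | w
  · exact hdual 0 (by rw [h0]; rfl) (by simp)
  · rcases le_or_gt ‖w‖ 1 with hw | hw
    · exact density_lower_of_norm_le_one T.f_holo T.g_holo T.lam_pos T.lam_eq hD h0 hw hd
    · have hw0 : w ≠ 0 := norm_pos_iff.1 (one_pos.trans hw)
      refine hdual w⁻¹ ?_ ?_
      · rw [h0]
        exact (sphInv_coe w).trans (if_neg hw0)
      · rw [norm_inv]
        exact inv_le_one_of_one_le₀ hw.le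

end DensityBound

/-- If `gₙ → g` locally uniformly (spherically) on `𝔻` for a sequence of Weierstrass
`m`-triples with `Kₙ(0) = -1/4`, `-1 ≤ Kₙ ≤ 0` and `dₙ(0) → ∞`, then the limit `g` is
nonconstant on `𝔻`. -/
theorem limit_gauss_map_nonconstant (m : ℕ) (hm : 0 < m)
    (T : ℕ → WeierstrassTriple m (Metric.ball (0:ℂ) 1)) (g : ℂ → OnePoint ℂ)
    (hconv : SphLocUnifOn (fun n => (T n).g) g (Metric.ball (0:ℂ) 1))
    (hK0 : ∀ n, (T n).curv 0 = -(1 / 4))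
    (hKbdd : ∀ n, ∀ z ∈ Metric.ball (0:ℂ) 1,
      -1 ≤ (T n).curv z ∧ (T n).curv z ≤ 0)
    (hd : Filter.Tendsto (fun n => distToBdry (T n).lam (Metric.ball (0:ℂ) 1) 0)
      Filter.atTop (nhds (⊤ : ℝ≥0∞))) :
    ∃ z ∈ Metric.ball (0:ℂ) 1, ∃ w ∈ Metric.ball (0:ℂ) 1, g z ≠ g w := by
  by_contra! hconst
  have h0 : (0 : ℂ) ∈ Metric.ball (0 : ℂ) 1 := by simp
  have hm' : (0 : ℝ) < m := by exact_mod_cast hm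
  set δ : ℝ := (4 * (5 * (5 : ℝ) ^ ((m : ℝ) / 2)))⁻¹ with hδ
  have hδ0 : 0 < δ := by positivity
  obtain ⟨ε, hε, hsmall⟩ := exists_abs_sphD_lt (g 0) (κ := δ / (8 * m)) (by positivity)
  have hsub : Metric.closedBall (0 : ℂ) (1 / 2) ⊆ Metric.ball 0 1 :=
    Metric.closedBall_subset_ball (by norm_num)
  obtain ⟨n, hn, hdn⟩ := ((hconv _ hsub (isCompact_closedBall _ _) ε hε).and
    (hd.eventually_const_le ENNReal.one_lt_top)).exists
  have h1 := hsmall (T n).g (T n).g_holo fun z hz => by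
    rw [hconst 0 h0 z (hsub hz)]
    exact hn z hz
  have h2 := (T n).density_lower hm (fun z hz => (hKbdd n z hz).1) hdn
  have h3 := hK0 n
  have hpos := (T n).lam_pos 0 h0
  rw [WeierstrassTriple.curv, div_eq_iff (by positivity), ← sq_abs (sphD _ _)] at h3
  have hm1 : (1 : ℝ) ≤ m := by exact_mod_cast hm
  rw [lt_div_iff₀ (by positivity)] at h1
  have h4 := abs_nonneg (sphD (T n).g 0)
  set s := |sphD (T n).g 0|
  have h5 : s * (8 * m) < (T n).lam 0 := h1.trans_le h2
  have h6 : (s * (8 * m)) ^ 2 < (T n).lam 0 ^ 2 := pow_lt_pow_left₀ h5 (by positivity) two_ne_zero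
  nlinarith [mul_nonneg (mul_nonneg hm'.le (sq_nonneg s))
    (sub_nonneg.2 hm1)]

end
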